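/- Let S be a semigroup and let R be an epsilon-strongly S-graded ring. Then R is graded von Neumann regular if and only if R_e is a von Neumann regular ring for every e ∈ E(S). -/

import Mathlib

open scoped Pointwise

/-- The set `E(S)` of idempotent elements of a semigroup `S`. -/
def idempotentSet (S : Type*) [Semigroup S] : Set S := {s | s * s = s}

/-- The set `V(s) = {t ∈ S ∣ sts = s and tst = t}`. -/
def invSet {S : Type*} [Semigroup S] (s : S) : Set S :=
  {t | s * t * s = s ∧ t * s * t = t}

/-- The product `A B` of two additive subgroups of a ring: the additive subgroup
generated by all products `a * b` with `a ∈ A`, `b ∈ B`. -/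
def subgroupMul {R : Type*} [NonUnitalRing R] (A B : AddSubgroup R) : AddSubgroup R :=
  AddSubgroup.closure ((A : Set R) * (B : Set R))

/-- `R` is an `S`-graded ring via the family `𝒜` of additive subgroups:
`R = ⊕_{s ∈ S} R_s` (internal direct sum) and `R_s R_t ⊆ R_{st}`. -/
structure IsSemigroupGrading {S R : Type*} [Semigroup S] [DecidableEq S] [NonUnitalRing R]
    (𝒜 : S → AddSubgroup R) : Prop where
  internal : DirectSum.IsInternal 𝒜
  mul_mem : ∀ s t : S, ∀ a ∈ 𝒜 s, ∀ b ∈ 𝒜 t, a * b ∈ 𝒜 (s * t)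

/-- `R` is symmetrically `S`-graded: `R_s = R_s R_t R_s` for all `s ∈ S`, `t ∈ V(s)`. -/
def SymmetricallyGraded {S R : Type*} [Semigroup S] [NonUnitalRing R]
    (𝒜 : S → AddSubgroup R) : Prop :=
  ∀ s : S, ∀ t ∈ invSet s, 𝒜 s = subgroupMul (subgroupMul (𝒜 s) (𝒜 t)) (𝒜 s)

/-- A subset `P` of `R` (closed under multiplication) is a unital ring:
it has a two-sided multiplicative identity element. -/
def HasUnity {R : Type*} [NonUnitalRing R] (P : AddSubgroup R) : Prop :=
  ∃ u ∈ P, ∀ x ∈ P, u * x = x ∧ x * u = x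

/-- A subset `P` of `R` is an s-unital ring: `x ∈ Px` and `x ∈ xP` for every `x ∈ P`. -/
def IsSUnital {R : Type*} [NonUnitalRing R] (P : AddSubgroup R) : Prop :=
  ∀ x ∈ P, (∃ u ∈ P, u * x = x) ∧ (∃ v ∈ P, x * v = x)

/-- A subset `P` of `R` is a von Neumann regular ring: `r ∈ rPr` for every `r ∈ P`. -/
def IsVonNeumannRegular {R : Type*} [NonUnitalRing R] (P : AddSubgroup R) : Prop :=
  ∀ r ∈ P, ∃ x ∈ P, r = r * x * r

/-- `R` is epsilon-strongly `S`-graded. -/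
def EpsilonStronglyGraded {S R : Type*} [Semigroup S] [NonUnitalRing R]
    (𝒜 : S → AddSubgroup R) : Prop :=
  SymmetricallyGraded 𝒜 ∧ ∀ s : S, ∀ t ∈ invSet s, HasUnity (subgroupMul (𝒜 s) (𝒜 t))

/-- `R` is nearly epsilon-strongly `S`-graded. -/
def NearlyEpsilonStronglyGraded {S R : Type*} [Semigroup S] [NonUnitalRing R]
    (𝒜 : S → AddSubgroup R) : Prop :=
  SymmetricallyGraded 𝒜 ∧ ∀ s : S, ∀ t ∈ invSet s, IsSUnital (subgroupMul (𝒜 s) (𝒜 t))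

/-- `R` is strongly `S`-graded: `R_s R_t = R_{st}` for all `s, t ∈ S`. -/
def StronglyGraded {S R : Type*} [Semigroup S] [NonUnitalRing R]
    (𝒜 : S → AddSubgroup R) : Prop :=
  ∀ s t : S, subgroupMul (𝒜 s) (𝒜 t) = 𝒜 (s * t)

/-- `R` is graded von Neumann regular: for all `s ∈ S`, `r ∈ R_s` and `t ∈ V(s)`,
there is `y ∈ R_t` with `r = ryr`. -/
def GradedVonNeumannRegular {S R : Type*} [Semigroup S] [NonUnitalRing R]
    (𝒜 : S → AddSubgroup R) : Prop :=
  ∀ s : S, ∀ r ∈ 𝒜 s, ∀ t ∈ invSet s, ∃ y ∈ 𝒜 t, r = r * y * r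

theorem mem_invSet_comm {S : Type*} [Semigroup S] {s t : S} (h : t ∈ invSet s) :
    s ∈ invSet t :=
  ⟨h.2, h.1⟩

theorem mem_invSet_self {S : Type*} [Semigroup S] {e : S} (he : e ∈ idempotentSet S) :
    e ∈ invSet e := by
  have he' : e * e = e := he
  constructor <;> simp only [he']

theorem mul_mem_subgroupMul {R : Type*} [NonUnitalRing R] {A B : AddSubgroup R} {a b : R}
    (ha : a ∈ A) (hb : b ∈ B) : a * b ∈ subgroupMul A B :=
  AddSubgroup.subset_closure (Set.mul_mem_mul ha hb)

/-- A right identity of `B A` acts as a right identity on `A B A`. -/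
theorem mul_eq_self_of_mem_subgroupMul_subgroupMul {R : Type*} [NonUnitalRing R]
    {A B : AddSubgroup R} {v : R} (hv : ∀ x ∈ subgroupMul B A, x * v = x) {r : R}
    (hr : r ∈ subgroupMul (subgroupMul A B) A) : r * v = r := by
  induction hr using AddSubgroup.closure_induction with
  | mem x hx =>
    obtain ⟨c, hc, d, hd, rfl⟩ := Set.mem_mul.1 hx
    have hc' : c ∈ subgroupMul A B := hc
    clear hc hx
    induction hc' using AddSubgroup.closure_induction with
    | mem x hx =>
      obtain ⟨p, hp, q, hq, rfl⟩ := Set.mem_mul.1 hx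
      rw [mul_assoc p q d, mul_assoc, hv _ (mul_mem_subgroupMul hq hd)]
    | zero => simp
    | add x y _ _ hx hy => rw [add_mul, add_mul, hx, hy]
    | neg x _ hx => rw [neg_mul, neg_mul, hx]
  | zero => simp
  | add x y _ _ hx hy => rw [add_mul, hx, hy]
  | neg x _ hx => rw [neg_mul, hx]

/-- If `R_{st}` is von Neumann regular, then a partial quasi-inverse `y ∈ R_t` of `r ∈ R_s` can be
improved so that it also works on a given `w ∈ R_t R_s`. -/
theorem exists_quasiInverse_extend {S R : Type*} [Semigroup S] [NonUnitalRing R]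
    {𝒜 : S → AddSubgroup R} (hmul : ∀ s t : S, ∀ a ∈ 𝒜 s, ∀ b ∈ 𝒜 t, a * b ∈ 𝒜 (s * t))
    {s t : S} (ht : t ∈ invSet s) (hreg : IsVonNeumannRegular (𝒜 (s * t)))
    {r : R} (hr : r ∈ 𝒜 s) {w : R} (hw : w ∈ subgroupMul (𝒜 t) (𝒜 s)) :
    ∀ y ∈ 𝒜 t, ∃ y' ∈ 𝒜 t, r * y' * r * w = r * w ∧
      ∀ x, r * y * r * x = r * x → r * y' * r * x = r * x := by
  have key : ∀ a ∈ 𝒜 t, ∀ b ∈ 𝒜 (s * t), a * b ∈ 𝒜 t := fun a ha b hb => by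
    simpa only [← mul_assoc, ht.2] using hmul _ _ a ha b hb
  induction hw using AddSubgroup.closure_induction with
  | mem w hw =>
    intro y hy
    obtain ⟨a, ha, b, -, rfl⟩ := Set.mem_mul.1 hw
    have ha' : a - y * (r * a) ∈ 𝒜 t := sub_mem ha (key y hy _ (hmul _ _ r hr a ha))
    set a' := a - y * (r * a) with ha'_def
    obtain ⟨x, hx, hxe⟩ := hreg (r * a') (hmul _ _ r hr a' ha')
    have hy' : y + a' * x - a' * x * (r * y) ∈ 𝒜 t :=
      sub_mem (add_mem hy (key a' ha' x hx))
        (key _ (key a' ha' x hx) _ (hmul _ _ r hr y hy))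
    have expand : ∀ z, r * (y + a' * x - a' * x * (r * y)) * r * z =
        r * y * r * z + r * a' * x * (r * z - r * y * r * z) := fun z => by
      noncomm_ring
    refine ⟨_, hy', ?_, fun z hz => ?_⟩
    · have hz : r * a - r * y * r * a = r * a' := by
        rw [ha'_def]; noncomm_ring
      rw [← mul_assoc _ a b, ← mul_assoc r a b, expand, hz, ← hxe, ← hz, add_sub_cancel]
    · rw [expand, hz, sub_self, mul_zero, add_zero]
  | zero => exact fun y hy => ⟨y, hy, by simp, fun _ h => h⟩
  | add w₁ w₂ _ _ h₁ h₂ =>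
    intro y hy
    obtain ⟨y₁, hy₁, hw₁, hx₁⟩ := h₁ y hy
    obtain ⟨y₂, hy₂, hw₂, hx₂⟩ := h₂ y₁ hy₁
    exact ⟨y₂, hy₂, by rw [mul_add, mul_add, hx₂ _ hw₁, hw₂], fun x h => hx₂ x (hx₁ x h)⟩
  | neg w _ h =>
    intro y hy
    obtain ⟨y', hy', hw', hx'⟩ := h y hy
    exact ⟨y', hy', by rw [mul_neg, mul_neg, hw'], hx'⟩

/-- **Corollary.** Let `S` be a semigroup and `R` an epsilon-strongly `S`-graded ring.
Then `R` is graded von Neumann regular if and only if `R_e` is von Neumann regular for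
every `e ∈ E(S)`. -/
theorem gradedVonNeumannRegular_iff_of_epsilonStronglyGraded
    {S R : Type*} [Semigroup S] [DecidableEq S] [NonUnitalRing R]
    (𝒜 : S → AddSubgroup R) (hgr : IsSemigroupGrading 𝒜)
    (heps : EpsilonStronglyGraded 𝒜) :
    GradedVonNeumannRegular 𝒜 ↔ ∀ e ∈ idempotentSet S, IsVonNeumannRegular (𝒜 e) := by
  constructor
  · intro h e he r hr
    exact h e r hr e (mem_invSet_self he)
  · intro h s r hr t ht
    have hst : s * t ∈ idempotentSet S := by
      change s * t * (s * t) = s * t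
      rw [← mul_assoc, ht.1]
    obtain ⟨v, hv, hunit⟩ := heps.2 t s (mem_invSet_comm ht)
    have hrv : r * v = r :=
      mul_eq_self_of_mem_subgroupMul_subgroupMul (fun x hx => (hunit x hx).2)
        (heps.1 s t ht ▸ hr)
    obtain ⟨y, hy, hyv, -⟩ :=
      exists_quasiInverse_extend hgr.mul_mem ht (h _ hst) hr hv 0 (zero_mem _)
    exact ⟨y, hy, by rwa [mul_assoc _ r v, hrv, eq_comm] at hyv⟩
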